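/- Consider the multi-user coded caching model with L levels, N_i ∈ ℕ+ files and U_i ∈ ℕ+ users per cache for each level i, and K ∈ ℕ+ caches, satisfying the regularity conditions. Let M be a real with 0 ≤ M ≤ N_1 + ⋯ + N_L, let (H, I, J) be any M-feasible partition of {1, …, L}, and let m_1, …, m_L be the associated memory-sharing allocation. Then the memory-sharing rate R(M) = Σ_{i=1}^{L} R^SL(m_i, K, N_i, U_i) satisfies R(M) ≤ 192·R*(M). -/

import Mathlib

/-- A library: each level `i` has `N i` files, and each file is an arbitrary
element of `{0,1}^F`. -/
def MULibrary (L : ℕ) (N : Fin L → ℕ+) (F : ℕ) : Type :=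
  (i : Fin L) → Fin (N i) → Fin F → Bool

/-- A demand vector of the multi-user setup: each of the `U i` users of level `i`
attached to cache `k` demands one file index of level `i`. -/
def MUDemand (L : ℕ) (N U : Fin L → ℕ+) (K : ℕ+) : Type :=
  (i : Fin L) → Fin K → Fin (U i) → Fin (N i)

/-- The pair `(R, M)` is achievable in the multi-user multi-level coded caching model
with `L` levels, `N i` files and `U i` users per cache for level `i`, and `K` caches:
`R, M ≥ 0` and, for every `ε > 0`, there are a file size `F` and a scheme consisting of
placement maps `Z k` into a set of cardinality at most `2^(M·F)`, encoding maps `X d`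
into a set of cardinality at most `2^((R+ε)·F)`, and decoding maps, such that every
user correctly recovers its demanded file for every library and every demand vector. -/
def MUAchievable (L : ℕ) (N U : Fin L → ℕ+) (K : ℕ+) (R M : ℝ) : Prop :=
  0 ≤ R ∧ 0 ≤ M ∧
  ∀ ε : ℝ, 0 < ε →
    ∃ (F : ℕ+) (zsize xsize : ℕ)
      (Z : Fin K → MULibrary L N F → Fin zsize)
      (X : MUDemand L N U K → MULibrary L N F → Fin xsize)
      (dec : (i : Fin L) → Fin K → Fin (U i) → MUDemand L N U K →
        Fin xsize → Fin zsize → (Fin F → Bool)),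
      (zsize : ℝ) ≤ (2 : ℝ) ^ (M * (F : ℝ)) ∧
      (xsize : ℝ) ≤ (2 : ℝ) ^ ((R + ε) * (F : ℝ)) ∧
      ∀ (w : MULibrary L N F) (d : MUDemand L N U K)
        (i : Fin L) (k : Fin K) (u : Fin (U i)),
        dec i k u d (X d w) (Z k w) = w i (d i k u)

/-- `R*(M)`: the optimal rate of the multi-user setup,
i.e. the infimum of the rates `R` such that `(R, M)` is achievable. -/
noncomputable def RstarMU (L : ℕ) (N U : Fin L → ℕ+) (K : ℕ+) (M : ℝ) : ℝ :=
  sInf {R | MUAchievable L N U K R M}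

/-- The single-level achievable rate
`R^SL(m, K, N, U) = U · min{N/m, K} · (1 − m/N)` for `0 < m ≤ N`, and
`R^SL(0, K, N, U) = U · K`. -/
noncomputable def RSL (m : ℝ) (K : ℕ+) (N U : ℝ) : ℝ :=
  if m = 0 then U * (K : ℝ) else U * min (N / m) (K : ℝ) * (1 - m / N)

/-- `S_A = ∑_{i∈A} √(N_i U_i)`. -/
noncomputable def SA {L : ℕ} (N U : Fin L → ℝ) (A : Finset (Fin L)) : ℝ :=
  ∑ i ∈ A, Real.sqrt (N i * U i)

/-- `T_A = ∑_{j∈A} N_j`. -/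
noncomputable def TA {L : ℕ} (N : Fin L → ℝ) (A : Finset (Fin L)) : ℝ :=
  ∑ j ∈ A, N j

/-- `V_A = ∑_{i∈A} N_i / K`. -/
noncomputable def VA (K : ℕ+) {L : ℕ} (N : Fin L → ℝ) (A : Finset (Fin L)) : ℝ :=
  ∑ i ∈ A, N i / (K : ℝ)

/-- `M̃ = (M − T_J + V_I) / S_I`. -/
noncomputable def Mtilde (K : ℕ+) {L : ℕ} (N U : Fin L → ℝ) (M : ℝ)
    (I J : Finset (Fin L)) : ℝ :=
  (M - TA N J + VA K N I) / SA N U I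

/-- `(H, I, J)` is an `M`-feasible partition of the set of levels `{1, …, L}`:
it is a partition with `I ≠ ∅` such that `M̃ < (1/K)√(N_h/U_h)` for `h ∈ H`,
`(1/K)√(N_i/U_i) ≤ M̃ ≤ (1 + 1/K)√(N_i/U_i)` for `i ∈ I`, and
`(1 + 1/K)√(N_j/U_j) < M̃` for `j ∈ J`. -/
def MFeasible (K : ℕ+) {L : ℕ} (N U : Fin L → ℝ) (M : ℝ)
    (H I J : Finset (Fin L)) : Prop :=
  Disjoint H I ∧ Disjoint H J ∧ Disjoint I J ∧ H ∪ I ∪ J = Finset.univ ∧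
  I.Nonempty ∧
  (∀ h ∈ H, Mtilde K N U M I J < (1 / (K : ℝ)) * Real.sqrt (N h / U h)) ∧
  (∀ i ∈ I, (1 / (K : ℝ)) * Real.sqrt (N i / U i) ≤ Mtilde K N U M I J ∧
      Mtilde K N U M I J ≤ (1 + 1 / (K : ℝ)) * Real.sqrt (N i / U i)) ∧
  (∀ j ∈ J, (1 + 1 / (K : ℝ)) * Real.sqrt (N j / U j) < Mtilde K N U M I J)


/-- The memory-sharing allocation associated with an `M`-feasible partition `(H, I, J)`:
`m_h = 0` for `h ∈ H`, `m_i = √(N_i U_i)·M̃ − N_i/K` for `i ∈ I`, `m_j = N_j` for `j ∈ J`. -/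
noncomputable def msAlloc (K : ℕ+) {L : ℕ} (N U : Fin L → ℝ) (M : ℝ)
    (H I J : Finset (Fin L)) (i : Fin L) : ℝ :=
  if i ∈ H then 0
  else if i ∈ I then Real.sqrt (N i * U i) * Mtilde K N U M I J - N i / (K : ℝ)
  else N i

/-- The constant `β = 1/80`. -/
noncomputable def betaML : ℝ := 1 / 80

/-- The regularity conditions: `N_i ≥ K·U_i` for every level `i`, and any two distinct
levels have popularities differing by a factor of at least `1/β²` (`β = 1/80`). -/
def RegularML (K : ℕ+) {L : ℕ} (N U : Fin L → ℝ) : Prop :=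
  (∀ i, (K : ℝ) * U i ≤ N i) ∧
  ∀ i j, i ≠ j →
    1 / betaML ^ 2 ≤ max ((U i / N i) / (U j / N j)) ((U j / N j) / (U i / N i))

section Converse

open Classical in
lemma aux_card_image_le_mul {Ω α β γ : Type} (S : Finset Ω) (f : Ω → α) (f1 : Ω → β) (f2 : Ω → γ)
    (h : ∀ w w', f1 w = f1 w' → f2 w = f2 w' → f w = f w') :
    (S.image f).card ≤ (S.image f1).card * (S.image f2).card := by
  rw [← Finset.card_product]
  have hsub : S.image (fun w => (f1 w, f2 w)) ⊆ S.image f1 ×ˢ S.image f2 := by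
    intro p hp
    obtain ⟨w, hw, rfl⟩ := Finset.mem_image.1 hp
    exact Finset.mem_product.2 ⟨Finset.mem_image_of_mem _ hw, Finset.mem_image_of_mem _ hw⟩
  refine le_trans ?_ (Finset.card_le_card hsub)
  rcases S.eq_empty_or_nonempty with rfl | ⟨w0, _⟩
  · simp
  have hex : ∀ p : β × γ, ∃ x : α, ∀ w, (f1 w, f2 w) = p → f w = x := by
    intro p
    by_cases hp : ∃ w, (f1 w, f2 w) = p
    · obtain ⟨w, rfl⟩ := hp
      refine ⟨f w, fun w' hw' => ?_⟩
      rw [Prod.mk.injEq] at hw'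
      exact h _ _ hw'.1 hw'.2
    · exact ⟨f w0, fun w hw => absurd ⟨w, hw⟩ hp⟩
  choose φ hφ using hex
  have : S.image f = (S.image (fun w => (f1 w, f2 w))).image φ := by
    rw [Finset.image_image]
    apply Finset.image_congr
    intro w _
    exact hφ _ w rfl
  rw [this]
  exact Finset.card_image_le

open Classical in
/-- number of values of `f` on `S`. -/
noncomputable def cntAux {Ω α : Type} (S : Finset Ω) (f : Ω → α) : ℕ := (S.image f).card

open Classical in
lemma cntAux_pos {Ω α : Type} {S : Finset Ω} (f : Ω → α) {w : Ω} (h : w ∈ S) : 0 < cntAux S f :=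
  Finset.card_pos.2 ⟨f w, Finset.mem_image_of_mem _ h⟩

open Classical in
lemma cntAux_mono {Ω α : Type} {S T : Finset Ω} (f : Ω → α) (h : S ⊆ T) :
    cntAux S f ≤ cntAux T f :=
  Finset.card_le_card (Finset.image_subset_image h)

open Classical in
lemma aux_exists_fiber {Ω V ι : Type} [Fintype V] [Nonempty V] (S : Finset Ω) (p : Ω → V)
    (hsurj : ∀ v, ∃ w ∈ S, p w = v) (G : Finset ι) (γ : ι → Type) (g : (b : ι) → Ω → γ b)
    (hdet : ∀ b ∈ G, ∀ w ∈ S, ∀ w' ∈ S, g b w = g b w' → p w = p w') :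
    ∃ v, ∑ b ∈ G, Real.log (cntAux (S.filter (fun w => p w = v)) (g b) : ℝ)
        + (G.card : ℝ) * Real.log (Fintype.card V : ℝ)
      ≤ ∑ b ∈ G, Real.log (cntAux S (g b) : ℝ) := by
  set n : ι → V → ℝ := fun b v => (cntAux (S.filter (fun w => p w = v)) (g b) : ℝ) with hn
  set B : ι → ℝ := fun b => (cntAux S (g b) : ℝ) with hB
  set c : ℝ := (Fintype.card V : ℝ) with hc
  have hcpos : 0 < c := by
    rw [hc]; exact_mod_cast Fintype.card_pos
  have hnpos : ∀ b v, 0 < n b v := by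
    intro b v
    obtain ⟨w, hw, hv⟩ := hsurj v
    have : 0 < cntAux (S.filter (fun w => p w = v)) (g b) := cntAux_pos _ (w := w) (by simp [hw, hv])
    simp only [hn]
    exact_mod_cast this
  have hBpos : ∀ b, 0 < B b := by
    intro b
    obtain ⟨w, hw, hv⟩ := hsurj (Classical.arbitrary V)
    simp only [hB]
    exact_mod_cast cntAux_pos (g b) hw
  have hsum : ∀ b ∈ G, ∑ v, n b v ≤ B b := by
    intro b hb
    simp only [hn, hB, cntAux]
    rw [← Nat.cast_sum]
    norm_cast
    rw [← Finset.card_biUnion]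
    · apply Finset.card_le_card
      intro x hx
      simp only [Finset.mem_biUnion, Finset.mem_image, Finset.mem_filter] at hx
      obtain ⟨v, _, w, ⟨hw, _⟩, rfl⟩ := hx
      exact Finset.mem_image_of_mem _ hw
    · intro v _ v' _ hvv'
      refine Finset.disjoint_left.2 ?_
      intro x hx hx'
      simp only [Finset.mem_image, Finset.mem_filter] at hx hx'
      obtain ⟨w, ⟨hw, hv⟩, rfl⟩ := hx
      obtain ⟨w', ⟨hw', hv'⟩, he⟩ := hx'
      exact hvv' (by rw [← hv, ← hv']; exact hdet b hb w hw w' hw' he.symm)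
  have key : ∀ b ∈ G, ∑ v, Real.log (n b v) ≤ c * (Real.log (B b) - Real.log c) := by
    intro b hb
    have h1 : ∀ v, Real.log (n b v) ≤ (Real.log (B b) - Real.log c) + (n b v * (c / B b) - 1) := by
      intro v
      have h2 : 0 < n b v * (c / B b) := mul_pos (hnpos b v) (div_pos hcpos (hBpos b))
      have h3 := Real.log_le_sub_one_of_pos h2
      rw [Real.log_mul (hnpos b v).ne' (div_pos hcpos (hBpos b)).ne',
        Real.log_div hcpos.ne' (hBpos b).ne'] at h3
      linarith
    calc ∑ v, Real.log (n b v)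
        ≤ ∑ v, ((Real.log (B b) - Real.log c) + (n b v * (c / B b) - 1)) :=
          Finset.sum_le_sum (fun v _ => h1 v)
      _ = c * (Real.log (B b) - Real.log c) + ((∑ v, n b v) * (c / B b) - c) := by
          rw [Finset.sum_add_distrib, Finset.sum_sub_distrib (f := fun v => n b v * (c / B b)), ← Finset.sum_mul]
          simp [hc, mul_sub]
      _ ≤ c * (Real.log (B b) - Real.log c) := by
          have : (∑ v, n b v) * (c / B b) ≤ B b * (c / B b) :=
            mul_le_mul_of_nonneg_right (hsum b hb) (div_pos hcpos (hBpos b)).le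
          rw [mul_div_cancel₀ _ (hBpos b).ne'] at this
          linarith
  by_contra hcon
  push Not at hcon
  have h1 : ∑ v : V, ∑ b ∈ G, Real.log (B b) <
      ∑ v : V, (∑ b ∈ G, Real.log (n b v) + (G.card : ℝ) * Real.log c) :=
    Finset.sum_lt_sum_of_nonempty Finset.univ_nonempty (fun v _ => hcon v)
  rw [Finset.sum_add_distrib, Finset.sum_comm (s := Finset.univ) (t := G)
    (f := fun v b => Real.log (n b v))] at h1
  have h2 := Finset.sum_le_sum key
  rw [← Finset.mul_sum, Finset.sum_sub_distrib] at h2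
  simp only [Finset.sum_const, Finset.card_univ, nsmul_eq_mul] at h1 h2
  rw [← hc] at h1
  nlinarith

lemma aux_sum_range_two_mul (f : ℕ → ℝ) (m : ℕ) :
    ∑ b ∈ Finset.range (2 * m), f b = ∑ b ∈ Finset.range m, (f (2 * b) + f (2 * b + 1)) := by
  induction m with
  | zero => simp
  | succ m ih =>
    rw [show 2 * (m + 1) = 2 * m + 1 + 1 by ring, Finset.sum_range_succ, Finset.sum_range_succ,
      Finset.sum_range_succ, ih]
    ring

noncomputable instance (L : ℕ) (N : Fin L → ℕ+) (F : ℕ) : Fintype (MULibrary L N F) := by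
  unfold MULibrary; infer_instance

/-- demand used for transmission number `τ`. -/
def dmAux (L : ℕ) (N U : Fin L → ℕ+) (K : ℕ+) (s0 t0 : ℕ) (a : Fin L → ℕ) (τ : ℕ) :
    MUDemand L N U K := fun i k u =>
  if h : ((τ % (t0 * 2 ^ a i)) * (s0 * 2 ^ a i) + k.val % (s0 * 2 ^ a i)) * (U i : ℕ) + u.val
      < (N i : ℕ)
  then ⟨_, h⟩ else ⟨0, (N i).pos⟩

/-- observation of the transmissions in `T` and the caches in `C`. -/
def obsAux {Ω : Type} {x z : ℕ} (X : ℕ → Ω → Fin x) (Z : ℕ → Ω → Fin z) (T C : Finset ℕ) (w : Ω) :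
    (T → Fin x) × (C → Fin z) := (fun τ => X τ w, fun k => Z k w)

lemma obsAux_eq_iff {Ω : Type} {x z : ℕ} (X : ℕ → Ω → Fin x) (Z : ℕ → Ω → Fin z)
    (T C : Finset ℕ) (w w' : Ω) :
    obsAux X Z T C w = obsAux X Z T C w' ↔
      (∀ τ ∈ T, X τ w = X τ w') ∧ (∀ k ∈ C, Z k w = Z k w') := by
  simp [obsAux, Prod.ext_iff, funext_iff]

/-- blocks -/
def blkAux (s b : ℕ) : Finset ℕ := Finset.Ico (b * s) ((b + 1) * s)

lemma blkAux_card (s b : ℕ) : (blkAux s b).card = s := by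
  simp [blkAux, add_mul]

lemma cntAux_obs_le {Ω : Type} {x z : ℕ} (X : ℕ → Ω → Fin x) (Z : ℕ → Ω → Fin z)
    (S : Finset Ω) (T C : Finset ℕ) : cntAux S (obsAux X Z T C) ≤ x ^ T.card * z ^ C.card := by
  refine le_trans (Finset.card_le_univ _) ?_
  simp

lemma aux_decode (L : ℕ) (N U : Fin L → ℕ+) (K : ℕ+) (F : ℕ) (zsize xsize : ℕ)
    (Z : Fin K → MULibrary L N F → Fin zsize)
    (X : MUDemand L N U K → MULibrary L N F → Fin xsize)
    (dec : (i : Fin L) → Fin K → Fin (U i) → MUDemand L N U K →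
        Fin xsize → Fin zsize → (Fin F → Bool))
    (hdec : ∀ (w : MULibrary L N F) (d : MUDemand L N U K)
        (i : Fin L) (k : Fin K) (u : Fin (U i)),
        dec i k u d (X d w) (Z k w) = w i (d i k u))
    (s0 t0 A : ℕ) (hs0 : 0 < s0) (ht0 : 0 < t0) (a : Fin L → ℕ)
    (hK : s0 * 2 ^ A ≤ K) (Z' : ℕ → MULibrary L N F → Fin zsize)
    (hZ' : ∀ (k : ℕ) (h : k < (K : ℕ)), Z' k = Z ⟨k, h⟩)
    (i : Fin L) (b : ℕ) (ha : a i ≤ A) (hb : b < 2 ^ (A - a i)) (w w' : MULibrary L N F)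
    (hobs : obsAux (fun τ => X (dmAux L N U K s0 t0 a τ)) Z' (blkAux (t0 * 2 ^ a i) b)
      (blkAux (s0 * 2 ^ a i) b) w = obsAux (fun τ => X (dmAux L N U K s0 t0 a τ)) Z'
      (blkAux (t0 * 2 ^ a i) b) (blkAux (s0 * 2 ^ a i) b) w')
    (n : Fin (N i)) (hn : n.val < 4 ^ a i * s0 * t0 * U i) : w i n = w' i n := by
  rw [obsAux_eq_iff] at hobs
  obtain ⟨hX, hZ⟩ := hobs
  have hUp : 0 < (U i : ℕ) := (U i).pos
  set s := s0 * 2 ^ a i with hs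
  set t := t0 * 2 ^ a i with ht
  have hsp : 0 < s := by positivity
  have htp : 0 < t := by positivity
  have hst : 4 ^ a i * s0 * t0 = t * s := by
    rw [hs, ht, show (4 : ℕ) = 2 * 2 by norm_num, mul_pow]; ring
  rw [hst] at hn
  set q := n.val / (U i : ℕ) with hq
  have hq1 : q < t * s := Nat.div_lt_of_lt_mul (by rwa [mul_comm])
  have hτ1 : q / s < t := Nat.div_lt_of_lt_mul (by rwa [mul_comm])
  have hk1 : q % s < s := Nat.mod_lt _ hsp
  have hkK : b * s + q % s < K := by
    have h1 : (b + 1) * s ≤ 2 ^ (A - a i) * s := Nat.mul_le_mul_right _ hb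
    have h2 : 2 ^ (A - a i) * s = s0 * 2 ^ A := by
      rw [hs, mul_comm, mul_assoc, ← pow_add, Nat.add_sub_cancel' ha]
    have h3 : (b + 1) * s = b * s + s := by ring
    omega
  have hu : n.val % (U i : ℕ) < U i := Nat.mod_lt _ hUp
  have hd : dmAux L N U K s0 t0 a (b * t + q / s) i ⟨b * s + q % s, hkK⟩ ⟨n.val % (U i : ℕ), hu⟩
      = n := by
    have e : (((b * t + q / s) % (t0 * 2 ^ a i)) * (s0 * 2 ^ a i) +
        (b * s + q % s) % (s0 * 2 ^ a i)) * (U i : ℕ) + n.val % (U i : ℕ) = n.val := by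
      rw [← hs, ← ht]
      rw [mul_comm b t, mul_comm b s, Nat.mul_add_mod, Nat.mul_add_mod, Nat.mod_eq_of_lt hτ1,
        Nat.mod_mod, mul_comm (q / s) s, Nat.div_add_mod, hq, mul_comm, Nat.div_add_mod]
    unfold dmAux
    simp only [e, n.isLt, dite_true]
  have h1 := hdec w (dmAux L N U K s0 t0 a (b * t + q / s)) i ⟨b * s + q % s, hkK⟩
    ⟨n.val % (U i : ℕ), hu⟩
  have h2 := hdec w' (dmAux L N U K s0 t0 a (b * t + q / s)) i ⟨b * s + q % s, hkK⟩
    ⟨n.val % (U i : ℕ), hu⟩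
  rw [hd] at h1 h2
  rw [← h1, ← h2, ← hZ']
  have e3 : X (dmAux L N U K s0 t0 a (b * t + q / s)) w =
      X (dmAux L N U K s0 t0 a (b * t + q / s)) w' := by
    apply hX
    simp only [blkAux, Finset.mem_Ico]
    constructor
    · exact Nat.le_add_right _ _
    · rw [add_mul, one_mul]; exact Nat.add_lt_add_left (by assumption) _
  have e4 : Z' (b * s + q % s) w = Z' (b * s + q % s) w' := by
    apply hZ
    simp only [blkAux, Finset.mem_Ico]
    constructor
    · exact Nat.le_add_right _ _
    · rw [add_mul, one_mul]; exact Nat.add_lt_add_left (by assumption) _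
  rw [e3, e4]

open Classical in
/-- libraries agreeing with `w0` on the relevant files of the levels with `a i < c`. -/
noncomputable def slcAux (L : ℕ) (N : Fin L → ℕ+) (F : ℕ) (a D : Fin L → ℕ) (c : ℕ)
    (w0 : MULibrary L N F) : Finset (MULibrary L N F) :=
  Finset.univ.filter (fun w => ∀ i, a i < c → ∀ n : Fin (N i), n.val < D i → w i n = w0 i n)

lemma aux_log_mono {m n : ℕ} (h0 : 0 < m) (h : m ≤ n) : Real.log (m : ℝ) ≤ Real.log (n : ℝ) :=
  Real.log_le_log (by exact_mod_cast h0) (by exact_mod_cast h)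

open Classical in
lemma aux_fix (L : ℕ) (N : Fin L → ℕ+) (F : ℕ) (a D : Fin L → ℕ) (c : ℕ)
    (hD : ∀ i, D i ≤ N i)
    (w0 : MULibrary L N F) (G : Finset ℕ) (γ : ℕ → Type) (g : (b : ℕ) → MULibrary L N F → γ b)
    (hdet : ∀ b ∈ G, ∀ w w', g b w = g b w' → ∀ i, a i = c → ∀ n : Fin (N i), n.val < D i →
      w i n = w' i n) :
    ∃ w1, ∑ b ∈ G, Real.log (cntAux (slcAux L N F a D (c + 1) w1) (g b) : ℝ)
        + (G.card : ℝ) * (∑ i ∈ Finset.univ.filter (fun i => a i = c), (D i : ℝ) * F * Real.log 2)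
      ≤ ∑ b ∈ G, Real.log (cntAux (slcAux L N F a D c w0) (g b) : ℝ) := by
  let V : Type := (i : {i // a i = c}) → Fin (D i.1) → Fin F → Bool
  let p : MULibrary L N F → V := fun w i n => w i.1 ⟨n.val, n.isLt.trans_le (hD _)⟩
  have hsurj : ∀ v, ∃ w ∈ slcAux L N F a D c w0, p w = v := by
    intro v
    refine ⟨fun i n => if h : a i = c ∧ n.val < D i then v ⟨i, h.1⟩ ⟨n.val, h.2⟩ else w0 i n, ?_, ?_⟩
    · refine Finset.mem_filter.2 ⟨Finset.mem_univ _, ?_⟩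
      intro i hi n hn
      dsimp only
      rw [dif_neg]
      rintro ⟨h, _⟩
      omega
    · funext i n
      simp only [p]
      rw [dif_pos ⟨i.2, n.isLt⟩]
  obtain ⟨v, hv⟩ := aux_exists_fiber (slcAux L N F a D c w0) p hsurj G γ g (by
    intro b hb w _ w' _ h
    funext i n
    exact hdet b hb w w' h i.1 i.2 _ n.isLt)
  obtain ⟨w1, hw1, hp1⟩ := hsurj v
  refine ⟨w1, ?_⟩
  have hcard : Real.log (Fintype.card V : ℝ) =
      ∑ i ∈ Finset.univ.filter (fun i => a i = c), (D i : ℝ) * F * Real.log 2 := by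
    have : Fintype.card V = ∏ i : {i // a i = c}, 2 ^ (F * D i.1) := by
      simp only [V, Fintype.card_pi, Fintype.card_bool, Finset.prod_const, Finset.card_univ,
        Fintype.card_fin, pow_mul]
    rw [this]
    push_cast
    rw [Real.log_prod (by intros; positivity)]
    rw [Finset.sum_subtype (Finset.univ.filter (fun i => a i = c)) (p := fun i => a i = c)
      (by simp)]
    apply Finset.sum_congr rfl
    intro i _
    rw [Real.log_pow]; push_cast; ring
  rw [hcard] at hv
  refine le_trans (add_le_add_left (Finset.sum_le_sum fun b hb => ?_) _) hv
  apply aux_log_mono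
  · exact cntAux_pos (w := w1) _ (by simp [slcAux])
  · apply cntAux_mono
    intro w hw
    simp only [slcAux, Finset.mem_filter, Finset.mem_univ, true_and] at hw hw1 ⊢
    refine ⟨fun i hi n hn => ?_, ?_⟩
    · rw [hw i (by omega) n hn, hw1 i hi n hn]
    · rw [← hp1]
      funext i n
      exact hw i.1 (by have := i.2; omega) _ n.isLt

open Classical in
lemma aux_merge {Ω : Type} {x z : ℕ} (X : ℕ → Ω → Fin x) (Z : ℕ → Ω → Fin z) (S : Finset Ω)
    (hS : S.Nonempty) (s t b : ℕ) :
    Real.log (cntAux S (obsAux X Z (blkAux (t * 2) b) (blkAux (s * 2) b)) : ℝ) ≤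
      Real.log (cntAux S (obsAux X Z (blkAux t (2 * b)) (blkAux s (2 * b))) : ℝ) +
      Real.log (cntAux S (obsAux X Z (blkAux t (2 * b + 1)) (blkAux s (2 * b + 1))) : ℝ) := by
  have hp : ∀ (T C : Finset ℕ), 0 < cntAux S (obsAux X Z T C) := fun T C =>
    cntAux_pos _ hS.choose_spec
  rw [← Real.log_mul (by exact_mod_cast (hp _ _).ne') (by exact_mod_cast (hp _ _).ne'),
    ← Nat.cast_mul]
  apply aux_log_mono (hp _ _)
  unfold cntAux
  apply aux_card_image_le_mul
  intro w w' h1 h2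
  rw [obsAux_eq_iff] at h1 h2 ⊢
  have hm : ∀ r k, k ∈ blkAux (r * 2) b → k ∈ blkAux r (2 * b) ∨ k ∈ blkAux r (2 * b + 1) := by
    intro r k hk
    simp only [blkAux, Finset.mem_Ico] at hk ⊢
    have e1 : b * (r * 2) = 2 * b * r := by ring
    have e2 : (b + 1) * (r * 2) = (2 * b + 1 + 1) * r := by ring
    rw [e1, e2] at hk
    omega
  constructor
  · intro τ hτ
    rcases hm _ _ hτ with h | h
    · exact h1.1 _ h
    · exact h2.1 _ h
  · intro τ hτ
    rcases hm _ _ hτ with h | h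
    · exact h1.2 _ h
    · exact h2.2 _ h

theorem aux_converse (L : ℕ) (N U : Fin L → ℕ+) (K : ℕ+) (F : ℕ) (zsize xsize : ℕ)
    (Z : Fin K → MULibrary L N F → Fin zsize)
    (X : MUDemand L N U K → MULibrary L N F → Fin xsize)
    (dec : (i : Fin L) → Fin K → Fin (U i) → MUDemand L N U K →
        Fin xsize → Fin zsize → (Fin F → Bool))
    (hdec : ∀ (w : MULibrary L N F) (d : MUDemand L N U K)
        (i : Fin L) (k : Fin K) (u : Fin (U i)),
        dec i k u d (X d w) (Z k w) = w i (d i k u))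
    (s0 t0 A : ℕ) (hs0 : 0 < s0) (ht0 : 0 < t0) (a : Fin L → ℕ) (ha : ∀ i, a i ≤ A)
    (hK : s0 * 2 ^ A ≤ K) :
    ∑ i, (2 : ℝ) ^ (A - a i) * ((min (N i : ℕ) (4 ^ a i * s0 * t0 * U i) : ℕ) : ℝ) * F * Real.log 2
      ≤ 2 ^ A * (t0 * Real.log xsize + s0 * Real.log zsize) := by
  classical
  let D : Fin L → ℕ := fun i => min (N i : ℕ) (4 ^ a i * s0 * t0 * U i)
  let Z' : ℕ → MULibrary L N F → Fin zsize := fun k =>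
    if h : k < K then Z ⟨k, h⟩ else Z ⟨0, K.pos⟩
  have hZ' : ∀ (k : ℕ) (h : k < (K : ℕ)), Z' k = Z ⟨k, h⟩ := fun k h => by simp [Z', h]
  let X' : ℕ → MULibrary L N F → Fin xsize := fun τ => X (dmAux L N U K s0 t0 a τ)
  let O : (c b : ℕ) → MULibrary L N F → _ := fun c b =>
    obsAux X' Z' (blkAux (t0 * 2 ^ c) b) (blkAux (s0 * 2 ^ c) b)
  have wz : MULibrary L N F := fun _ _ _ => false
  have hzp : 0 < zsize := Fin.pos (Z' 0 wz)
  have hxp : 0 < xsize := Fin.pos (X' 0 wz)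
  have hmem : ∀ c w, w ∈ slcAux L N F a D c w := by intro c w; simp [slcAux]
  -- fixing step
  have fix : ∀ c ≤ A, ∀ w0, ∃ w1,
      ∑ b ∈ Finset.range (2 ^ (A - c)),
        Real.log (cntAux (slcAux L N F a D (c + 1) w1) (O c b) : ℝ)
        + (2 : ℝ) ^ (A - c) * (∑ i ∈ Finset.univ.filter (fun i => a i = c),
          (D i : ℝ) * F * Real.log 2)
      ≤ ∑ b ∈ Finset.range (2 ^ (A - c)),
        Real.log (cntAux (slcAux L N F a D c w0) (O c b) : ℝ) := by
    intro c hc w0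
    have := aux_fix L N F a D c (fun i => min_le_left _ _) w0 (Finset.range (2 ^ (A - c))) _ (O c) (by
      intro b hb w w' h i hi n hn
      subst hi
      exact aux_decode L N U K F zsize xsize Z X dec hdec s0 t0 A hs0 ht0 a hK Z' hZ' i b hc
        (Finset.mem_range.1 hb) w w' h n (lt_of_lt_of_le hn (min_le_right _ _)))
    rw [Finset.card_range] at this
    push_cast at this
    exact this
  have hsplit : ∀ c, ∑ i ∈ Finset.univ.filter (fun i => a i < c + 1),
        (2 : ℝ) ^ (A - a i) * (D i : ℝ) * F * Real.log 2 =
      ∑ i ∈ Finset.univ.filter (fun i => a i < c),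
        (2 : ℝ) ^ (A - a i) * (D i : ℝ) * F * Real.log 2 +
      (2 : ℝ) ^ (A - c) * (∑ i ∈ Finset.univ.filter (fun i => a i = c),
          (D i : ℝ) * F * Real.log 2) := by
    intro c
    have h1 : Finset.univ.filter (fun i => a i < c + 1) =
        Finset.univ.filter (fun i => a i < c) ∪ Finset.univ.filter (fun i => a i = c) := by
      ext i; simp; omega
    rw [h1, Finset.sum_union, Finset.mul_sum]
    · congr 1
      apply Finset.sum_congr rfl
      intro i hi
      rw [(Finset.mem_filter.1 hi).2]; ring
    · rw [Finset.disjoint_left]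
      intro i hi hi'
      have := (Finset.mem_filter.1 hi).2
      have := (Finset.mem_filter.1 hi').2
      omega
  have inv : ∀ c ≤ A, ∃ w0,
      ∑ b ∈ Finset.range (2 ^ (A - c)),
        Real.log (cntAux (slcAux L N F a D c w0) (O c b) : ℝ)
      + ∑ i ∈ Finset.univ.filter (fun i => a i < c),
        (2 : ℝ) ^ (A - a i) * (D i : ℝ) * F * Real.log 2
      ≤ 2 ^ A * (t0 * Real.log xsize + s0 * Real.log zsize) := by
    intro c
    induction c with
    | zero =>
      intro _
      refine ⟨wz, ?_⟩
      have h1 : ∀ b, Real.log (cntAux (slcAux L N F a D 0 wz) (O 0 b) : ℝ) ≤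
          t0 * Real.log xsize + s0 * Real.log zsize := by
        intro b
        have h2 : cntAux (slcAux L N F a D 0 wz) (O 0 b) ≤ xsize ^ t0 * zsize ^ s0 := by
          refine le_trans (cntAux_obs_le X' Z' _ _ _) ?_
          rw [blkAux_card, blkAux_card, pow_zero, mul_one, mul_one]
        refine le_trans (aux_log_mono (cntAux_pos _ (hmem 0 wz)) h2) ?_
        push_cast
        rw [Real.log_mul (by positivity) (by positivity), Real.log_pow, Real.log_pow]
      simp only [Nat.not_lt_zero, Finset.filter_false, Finset.sum_empty, add_zero, Nat.sub_zero]
      refine le_trans (Finset.sum_le_sum (fun b _ => h1 b)) ?_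
      simp [mul_add]
    | succ c ih =>
      intro hc
      obtain ⟨w0, hw0⟩ := ih (by omega)
      obtain ⟨w1, hw1⟩ := fix c (by omega) w0
      refine ⟨w1, ?_⟩
      rw [hsplit]
      have h2 : 2 ^ (A - c) = 2 * 2 ^ (A - (c + 1)) := by
        rw [← pow_succ']; congr 1; omega
      have h3 : ∑ b ∈ Finset.range (2 ^ (A - (c + 1))),
          Real.log (cntAux (slcAux L N F a D (c + 1) w1) (O (c + 1) b) : ℝ) ≤
          ∑ b ∈ Finset.range (2 ^ (A - c)),
          Real.log (cntAux (slcAux L N F a D (c + 1) w1) (O c b) : ℝ) := by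
        rw [h2, aux_sum_range_two_mul]
        apply Finset.sum_le_sum
        intro b _
        have := aux_merge X' Z' (slcAux L N F a D (c + 1) w1) ⟨w1, hmem _ _⟩
          (s0 * 2 ^ c) (t0 * 2 ^ c) b
        simp only [O]
        rw [pow_succ, ← mul_assoc, ← mul_assoc]
        exact this
      linarith
  obtain ⟨w0, hw0⟩ := inv A le_rfl
  obtain ⟨w1, hw1⟩ := fix A le_rfl w0
  have h4 : 0 ≤ ∑ b ∈ Finset.range (2 ^ (A - A)),
        Real.log (cntAux (slcAux L N F a D (A + 1) w1) (O A b) : ℝ) :=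
    Finset.sum_nonneg (fun b _ => Real.log_natCast_nonneg _)
  have h5 := hsplit A
  rw [Finset.filter_true_of_mem (s := Finset.univ) (p := fun i => a i < A + 1)
    (fun i _ => Nat.lt_succ_of_le (ha i))] at h5
  have : ∑ i, (2 : ℝ) ^ (A - a i) * (D i : ℝ) * F * Real.log 2
      ≤ 2 ^ A * (t0 * Real.log xsize + s0 * Real.log zsize) := by linarith
  exact this

end Converse

section RealPart

lemma aux_params (K y : ℝ) (hK : 1 ≤ K) (hy : 0 < y) (hKy : 1 ≤ K * y ^ 2) :
    ∃ s0 t0 : ℕ, 0 < s0 ∧ 0 < t0 ∧ (s0 : ℝ) * (16 * y ^ 2) ≤ t0 ∧ (t0 : ℝ) ≤ 32 * y ^ 2 * s0 ∧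
      (s0 = 1 ∨ (t0 = 1 ∧ 16 * (s0 : ℝ) ≤ K)) ∧ (s0 : ℝ) ≤ K := by
  have hy2 : 0 < 16 * y ^ 2 := by positivity
  by_cases h : 1 ≤ 16 * y ^ 2
  · refine ⟨1, ⌈16 * y ^ 2⌉₊, one_pos, Nat.ceil_pos.2 hy2, ?_, ?_, Or.inl rfl, by simpa using hK⟩
    · have := Nat.le_ceil (16 * y ^ 2)
      push_cast; linarith
    · have := Nat.ceil_lt_add_one hy2.le
      push_cast; linarith
  · push Not at h
    have hx : 1 ≤ 1 / (16 * y ^ 2) := by rw [le_div_iff₀ hy2]; linarith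
    have hfl : (⌊1 / (16 * y ^ 2)⌋₊ : ℝ) ≤ 1 / (16 * y ^ 2) := Nat.floor_le (by positivity)
    have hpos : 0 < ⌊1 / (16 * y ^ 2)⌋₊ := Nat.floor_pos.2 hx
    have hp1 : (1 : ℝ) ≤ (⌊1 / (16 * y ^ 2)⌋₊ : ℝ) := by exact_mod_cast hpos
    have hlt := Nat.lt_floor_add_one (1 / (16 * y ^ 2))
    have hKK : 16 * (⌊1 / (16 * y ^ 2)⌋₊ : ℝ) ≤ K := by
      have : 1 / (16 * y ^ 2) ≤ K / 16 := by
        rw [div_le_div_iff₀ hy2 (by norm_num)]; linarith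
      linarith
    refine ⟨⌊1 / (16 * y ^ 2)⌋₊, 1, hpos, one_pos, ?_, ?_, Or.inr ⟨rfl, hKK⟩, by linarith⟩
    · rw [le_div_iff₀ hy2] at hfl
      simpa using hfl
    · have h2 : 1 / (16 * y ^ 2) < 2 * (⌊1 / (16 * y ^ 2)⌋₊ : ℝ) := by linarith
      rw [div_lt_iff₀ hy2] at h2
      push_cast; linarith

lemma aux_RSL_bound (K : ℕ+) (U r y m : ℝ) (hU : 0 < U) (hr : 0 < r) (hy : 0 < y)
    (hm : m = U * r ^ 2 * (y / r - 1 / (K : ℝ))) (hq0 : 1 / (K : ℝ) ≤ y / r)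
    (hq1 : y / r ≤ 1 + 1 / (K : ℝ)) :
    RSL m K (U * r ^ 2) U ≤ 2 * U * r / y * (1 - (y / r - 1 / (K : ℝ))) ∧
      RSL m K (U * r ^ 2) U ≤ 2 * U * r / y := by
  have hK : (0 : ℝ) < (K : ℝ) := by exact_mod_cast K.pos
  have hN : 0 < U * r ^ 2 := by positivity
  set q := y / r - 1 / (K : ℝ) with hq
  have hq0' : 0 ≤ q := by linarith
  have hq1' : q ≤ 1 := by linarith
  have hx : y / r = q + 1 / (K : ℝ) := by rw [hq]; ring
  have hxp : 0 < y / r := by positivity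
  have hE : 2 * U * r / y = U * (2 / (y / r)) := by field_simp
  have hmain : RSL m K (U * r ^ 2) U ≤ 2 * U * r / y * (1 - q) := by
    unfold RSL
    split_ifs with h0
    · have hq00 : q = 0 := by
        rw [hm] at h0
        rcases mul_eq_zero.1 h0 with h | h
        · exact absurd h hN.ne'
        · exact h
      rw [hE, hx, hq00]
      have : 2 / (0 + 1 / (K : ℝ)) = 2 * K := by field_simp; ring
      rw [this]
      nlinarith [mul_pos hU hK]
    · have hqne : q ≠ 0 := by
        intro h; apply h0; rw [hm, h, mul_zero]
      have hqp : 0 < q := lt_of_le_of_ne hq0' (Ne.symm hqne)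
      have e1 : U * r ^ 2 / m = 1 / q := by rw [hm]; field_simp
      have e2 : m / (U * r ^ 2) = q := by rw [hm]; field_simp
      rw [e1, e2, hE]
      apply mul_le_mul_of_nonneg_right _ (by linarith)
      apply mul_le_mul_of_nonneg_left _ hU.le
      rw [hx]
      have hKi : 0 < 1 / (K : ℝ) := by positivity
      rcases le_total (1 / (K : ℝ)) q with h | h
      · refine le_trans (min_le_left _ _) ?_
        rw [div_le_div_iff₀ hqp (by linarith)]; linarith
      · refine le_trans (min_le_right _ _) ?_
        rw [le_div_iff₀ (by linarith)]
        have : (K : ℝ) * q ≤ K * (1 / K) := mul_le_mul_of_nonneg_left h hK.le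
        have e : (K : ℝ) * (1 / K) = 1 := by field_simp
        rw [mul_add]; linarith
  refine ⟨hmain, hmain.trans ?_⟩
  have : 0 < 2 * U * r / y := by positivity
  nlinarith

lemma aux_levelH (K U r y : ℝ) (s0 t0 A : ℕ) (hs : 0 < s0) (ht : 0 < t0) (hU : 0 < U) (hy : 0 < y)
    (hK : 1 ≤ K)
    (h2 : (t0 : ℝ) ≤ 32 * y ^ 2 * s0) (hA1 : (s0 : ℝ) * 2 ^ A ≤ K) (hA2 : K < s0 * 2 ^ A * 2)
    (hr : K * y < r) :
    t0 * (U * K) ≤ 192 * (min (U * r ^ 2) (4 ^ A * s0 * t0 * U) / 2 ^ A - s0 * 0) := by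
  set g : ℝ := 2 ^ A with hg
  have h4 : (4 : ℝ) ^ A = g * g := by rw [hg, ← mul_pow]; norm_num
  have hgp : 0 < g := by positivity
  have hsp : (0 : ℝ) < s0 := by exact_mod_cast hs
  have htp : (0 : ℝ) < t0 := by exact_mod_cast ht
  rw [h4, mul_zero, sub_zero, mul_div_assoc', le_div_iff₀ hgp]
  have hUt : 0 < U * t0 := by positivity
  have c1 : t0 * (U * K) * g ≤ 192 * (U * r ^ 2) := by
    have a1 : t0 * (K * g) ≤ 32 * y ^ 2 * s0 * (K * g) :=
      mul_le_mul_of_nonneg_right h2 (by positivity)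
    have a2 : 32 * y ^ 2 * s0 * (K * g) ≤ 32 * y ^ 2 * K * K := by
      have := mul_le_mul_of_nonneg_left hA1 (show 0 ≤ 32 * y ^ 2 * K by positivity)
      linarith
    have a3 : (K * y) ^ 2 ≤ r ^ 2 := pow_le_pow_left₀ (by positivity) hr.le 2
    have a4 : t0 * (K * g) ≤ 192 * r ^ 2 := by nlinarith [sq_nonneg r]
    nlinarith
  have c2 : t0 * (U * K) * g ≤ 192 * (g * g * s0 * t0 * U) := by
    have := mul_le_mul_of_nonneg_left hA2.le (show 0 ≤ U * t0 * g by positivity)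
    have : 0 < g * g * s0 * t0 * U := by positivity
    nlinarith
  rcases min_cases (U * r ^ 2) (g * g * s0 * t0 * U) with ⟨h, _⟩ | ⟨h, _⟩ <;> rw [h] <;> assumption

lemma aux_levelI (K : ℕ+) (U r y m : ℝ) (s0 t0 A : ℕ) (hs : 0 < s0) (ht : 0 < t0)
    (hU : 0 < U) (hr : 0 < r) (hy : 0 < y) (hrK : (K : ℝ) ≤ r ^ 2)
    (hm : m = U * r ^ 2 * (y / r - 1 / (K : ℝ))) (hq0 : 1 / (K : ℝ) ≤ y / r)
    (hq1 : y / r ≤ 1 + 1 / (K : ℝ))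
    (h1 : (s0 : ℝ) * (16 * y ^ 2) ≤ t0)
    (h2 : (t0 : ℝ) ≤ 32 * y ^ 2 * s0) (h3 : s0 = 1 ∨ (t0 = 1 ∧ 16 * (s0 : ℝ) ≤ K))
    (hA2 : (K : ℝ) < s0 * 2 ^ A * 2) :
    ∃ a ≤ A, t0 * RSL m K (U * r ^ 2) U ≤
      192 * (min (U * r ^ 2) (4 ^ a * s0 * t0 * U) / 2 ^ a - s0 * m) := by
  have hK1 : (1 : ℝ) ≤ (K : ℝ) := by exact_mod_cast K.pos
  have hsp : (0 : ℝ) < s0 := by exact_mod_cast hs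
  have htp : (0 : ℝ) < t0 := by exact_mod_cast ht
  obtain ⟨hb1, hb2⟩ := aux_RSL_bound K U r y m hU hr hy hm hq0 hq1
  have hryK : r ≤ K * y := by
    rw [div_le_div_iff₀ (by linarith) hr] at hq0; linarith
  have hy2r : y ≤ 2 * r := by
    have : 1 / (K : ℝ) ≤ 1 := by rw [div_le_one (by linarith)]; exact hK1
    have : y / r ≤ 2 := by linarith
    rw [div_le_iff₀ hr] at this; exact this
  by_cases hc : (s0 : ℝ) * t0 ≤ r ^ 2
  · have hst : (0 : ℝ) < s0 * t0 := by positivity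
    obtain ⟨a, ha1, ha2⟩ := exists_nat_pow_near (x := r ^ 2 / (s0 * t0)) (y := (4 : ℝ))
      (by rw [le_div_iff₀ hst]; linarith) (by norm_num)
    rw [le_div_iff₀ hst] at ha1
    rw [div_lt_iff₀ hst, pow_succ (4 : ℝ) a] at ha2
    have h4 : (4 : ℝ) ^ a = 2 ^ a * 2 ^ a := by rw [← mul_pow]; norm_num
    have hgp : (0 : ℝ) < 2 ^ a := by positivity
    have haA : a ≤ A := by
      by_contra hcon
      push Not at hcon
      have e1 : (2 : ℝ) ^ (A + 1) ≤ 2 ^ a := pow_le_pow_right₀ (by norm_num) hcon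
      have e2 : (K : ℝ) < s0 * 2 ^ a := by
        have := mul_le_mul_of_nonneg_left e1 hsp.le
        rw [pow_succ] at this
        linarith
      -- `(s0 g)^2 * 16 y^2 ≤ r^2`
      have e3 : ((s0 : ℝ) * 2 ^ a) ^ 2 * (16 * y ^ 2) ≤ r ^ 2 := by
        have := mul_le_mul_of_nonneg_left h1 (show 0 ≤ (s0 : ℝ) * (2 ^ a * 2 ^ a) by positivity)
        rw [h4] at ha1
        nlinarith
      have e4 : (K : ℝ) ^ 2 < ((s0 : ℝ) * 2 ^ a) ^ 2 :=
        pow_lt_pow_left₀ e2 (by linarith) (by norm_num)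
      have e5 : r ^ 2 ≤ (K * y) ^ 2 := pow_le_pow_left₀ hr.le hryK 2
      have e6 : (K : ℝ) ^ 2 * (16 * y ^ 2) < ((s0 : ℝ) * 2 ^ a) ^ 2 * (16 * y ^ 2) :=
        mul_lt_mul_of_pos_right e4 (by positivity)
      have e7 : 0 < (K : ℝ) ^ 2 * y ^ 2 := by positivity
      nlinarith
    refine ⟨a, haA, ?_⟩
    have hmin : min (U * r ^ 2) (4 ^ a * s0 * t0 * U) = 4 ^ a * s0 * t0 * U := by
      apply min_eq_right
      have := mul_le_mul_of_nonneg_right ha1 hU.le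
      linarith
    rw [hmin, h4]
    set g : ℝ := 2 ^ a with hg
    have e0 : g * g * s0 * t0 * U / g = g * s0 * t0 * U := by field_simp
    rw [e0]
    rw [h4] at ha1 ha2
    have f1 : r * y ≤ g * t0 / 2 := by
      refine (sq_le_sq₀ (by positivity) (by positivity)).1 ?_
      have k1 : r ^ 2 * y ^ 2 ≤ g * g * 4 * (s0 * t0) * y ^ 2 :=
        mul_le_mul_of_nonneg_right ha2.le (by positivity)
      have k2 := mul_le_mul_of_nonneg_left h1 (show 0 ≤ g * g * t0 by positivity)
      nlinarith
    have f2 : r ≤ 48 * (g * s0 * y) := by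
      refine (sq_le_sq₀ (by positivity) (by positivity)).1 ?_
      have k2 := mul_le_mul_of_nonneg_left h2 (show 0 ≤ g * g * 4 * s0 by positivity)
      have k3 : 0 ≤ (g * s0 * y) ^ 2 := by positivity
      nlinarith
    have f3 : m ≤ U * (r * y) := by
      have : U * r ^ 2 * (y / r - 1 / (K : ℝ)) = U * (r * y) - U * r ^ 2 * (1 / (K : ℝ)) := by
        field_simp
      rw [hm, this]
      have : 0 ≤ U * r ^ 2 * (1 / (K : ℝ)) := by positivity
      linarith
    have f4 : 2 * U * r / y ≤ 96 * (U * g * s0) := by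
      rw [div_le_iff₀ hy]
      have := mul_le_mul_of_nonneg_left f2 hU.le
      linarith
    have f5 : s0 * m ≤ g * s0 * t0 * U / 2 := by
      have k1 := mul_le_mul_of_nonneg_left f3 hsp.le
      have k2 := mul_le_mul_of_nonneg_left f1 (show 0 ≤ (s0 : ℝ) * U by positivity)
      linarith
    have f6 := mul_le_mul_of_nonneg_left (hb2.trans f4) htp.le
    linarith
  · push Not at hc
    have hs1 : s0 = 1 := by
      rcases h3 with h | ⟨h, h'⟩
      · exact h
      · exfalso
        rw [h] at hc
        push_cast at hc
        linarith
    subst hs1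
    refine ⟨0, Nat.zero_le _, ?_⟩
    push_cast at *
    have hmin : min (U * r ^ 2) (4 ^ 0 * 1 * t0 * U) = U * r ^ 2 := by
      apply min_eq_left
      have := mul_le_mul_of_nonneg_right hc.le hU.le
      linarith
    rw [hmin, pow_zero, div_one, one_mul]
    have f1 : 192 * (U * r ^ 2 - m) = 192 * (U * r ^ 2) * (1 - (y / r - 1 / (K : ℝ))) := by
      rw [hm]; ring
    rw [f1]
    have f2 := mul_le_mul_of_nonneg_left hb1 htp.le
    refine f2.trans ?_
    rw [← mul_assoc]
    apply mul_le_mul_of_nonneg_right _ (by linarith)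
    rw [mul_div_assoc', div_le_iff₀ hy]
    have f3 : (t0 : ℝ) ≤ 64 * (r * y) := by
      have := mul_le_mul_of_nonneg_right hy2r hy.le
      linarith
    have := mul_le_mul_of_nonneg_left f3 (show 0 ≤ 2 * U * r by positivity)
    have : 0 < U * r ^ 2 * y := by positivity
    linarith

lemma aux_levelJ (K : ℕ+) (U r y : ℝ) (s0 t0 : ℕ)
    (hU : 0 < U) (hr : 0 < r) (hrK : (K : ℝ) ≤ r ^ 2)
    (hq1 : (1 + 1 / (K : ℝ)) * r < y)
    (h1 : (s0 : ℝ) * (16 * y ^ 2) ≤ t0) (hs : 0 < s0)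
    (h3 : s0 = 1 ∨ (t0 = 1 ∧ 16 * (s0 : ℝ) ≤ K)) :
    t0 * RSL (U * r ^ 2) K (U * r ^ 2) U ≤
      192 * (min (U * r ^ 2) (4 ^ 0 * s0 * t0 * U) / 2 ^ 0 - s0 * (U * r ^ 2)) := by
  have hK1 : (1 : ℝ) ≤ (K : ℝ) := by exact_mod_cast K.pos
  have hN : 0 < U * r ^ 2 := by positivity
  have h0 : RSL (U * r ^ 2) K (U * r ^ 2) U = 0 := by
    unfold RSL
    rw [if_neg hN.ne', div_self hN.ne']
    simp
  have hry : r ≤ y := by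
    have : 0 < 1 / (K : ℝ) * r := by positivity
    nlinarith
  have hry2 : r ^ 2 ≤ y ^ 2 := pow_le_pow_left₀ hr.le hry 2
  have hs1 : s0 = 1 := by
    rcases h3 with h | ⟨h, h'⟩
    · exact h
    · exfalso
      have : (1 : ℝ) ≤ s0 := by exact_mod_cast hs
      rw [h] at h1
      push_cast at h1
      nlinarith
  subst hs1
  push_cast at *
  rw [h0, min_eq_left]
  · simp
  · have : r ^ 2 ≤ t0 := by nlinarith
    have := mul_le_mul_of_nonneg_right this hU.le
    linarith

end RealPart

section MainPart

lemma aux_nonempty (L : ℕ) (N U : Fin L → ℕ+) (K : ℕ+) (M : ℝ) (hM : 0 ≤ M) :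
    ∃ R, MUAchievable L N U K R M := by
  classical
  refine ⟨∑ i, (K : ℝ) * ((U i : ℕ) : ℝ), by positivity, hM, fun ε hε => ?_⟩
  let Y : Type := (i : Fin L) → Fin K → Fin (U i) → (Fin 1 → Bool)
  let e : Y ≃ Fin (Fintype.card Y) := Fintype.equivFin Y
  refine ⟨1, 1, Fintype.card Y, fun _ _ => 0, fun d w => e (fun i k u => w i (d i k u)),
    fun i k u _ x _ => e.symm x i k u, ?_, ?_, ?_⟩
  · have : (1 : ℝ) ≤ 2 ^ (M * ((1 : ℕ+) : ℕ) : ℝ) :=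
      Real.one_le_rpow (by norm_num) (by positivity)
    simpa using this
  · have hc : Fintype.card Y = 2 ^ (∑ i, (K : ℕ) * (U i : ℕ)) := by
      simp only [Y, Fintype.card_pi, Fintype.card_bool, Finset.prod_const, Finset.card_univ,
        Fintype.card_fin, pow_one]
      rw [← Finset.prod_pow_eq_pow_sum]
      apply Finset.prod_congr rfl
      intro i _
      rw [← pow_mul, mul_comm]
    rw [hc]
    push_cast
    rw [← Real.rpow_natCast]
    apply Real.rpow_le_rpow_of_exponent_le (by norm_num)
    push_cast
    linarith
  · intro w d i k u
    exact congrFun (congrFun (congrFun (e.symm_apply_apply _) i) k) u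

theorem aux_rate (L : ℕ) (N U : Fin L → ℕ+) (K : ℕ+) (R M : ℝ) (hach : MUAchievable L N U K R M)
    (s0 t0 A : ℕ) (hs0 : 0 < s0) (ht0 : 0 < t0) (a : Fin L → ℕ) (ha : ∀ i, a i ≤ A)
    (hK : s0 * 2 ^ A ≤ (K : ℕ)) :
    ∑ i, min ((N i : ℕ) : ℝ) (4 ^ a i * s0 * t0 * ((U i : ℕ) : ℝ)) / 2 ^ a i ≤ t0 * R + s0 * M := by
  apply le_of_forall_pos_le_add
  intro δ hδ
  have htp : (0 : ℝ) < t0 := by exact_mod_cast ht0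
  obtain ⟨F, zsize, xsize, Z, X, dec, hz, hx, hdec⟩ := hach.2.2 (δ / t0) (by positivity)
  have hconv := aux_converse L N U K F zsize xsize Z X dec hdec s0 t0 A hs0 ht0 a ha hK
  have w : MULibrary L N F := fun _ _ _ => false
  have hzp : (0 : ℝ) < zsize := by exact_mod_cast Fin.pos (Z ⟨0, K.pos⟩ w)
  have hxp : (0 : ℝ) < xsize := by
    exact_mod_cast Fin.pos (X (fun i _ _ => ⟨0, (N i).pos⟩) w)
  have hl2 : 0 < Real.log 2 := Real.log_pos (by norm_num)
  have hFp : (0 : ℝ) < ((F : ℕ) : ℝ) := by exact_mod_cast F.pos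
  have hlz := Real.log_le_log hzp hz
  have hlx := Real.log_le_log hxp hx
  rw [Real.log_rpow (by norm_num)] at hlz hlx
  have hfl : 0 < ((F : ℕ) : ℝ) * Real.log 2 := by positivity
  have h2A : (0 : ℝ) < 2 ^ A := by positivity
  have e1 : ∑ i, (2 : ℝ) ^ (A - a i) * ((min (N i : ℕ) (4 ^ a i * s0 * t0 * U i) : ℕ) : ℝ) * F
        * Real.log 2 = 2 ^ A * (((F : ℕ) : ℝ) * Real.log 2) *
      ∑ i, min ((N i : ℕ) : ℝ) (4 ^ a i * s0 * t0 * ((U i : ℕ) : ℝ)) / 2 ^ a i := by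
    rw [Finset.mul_sum]
    apply Finset.sum_congr rfl
    intro i _
    rw [pow_sub₀ _ (by norm_num) (ha i)]
    push_cast
    field_simp
  rw [e1] at hconv
  have e2 : t0 * Real.log xsize + s0 * Real.log zsize ≤
      (((F : ℕ) : ℝ) * Real.log 2) * (t0 * R + s0 * M + δ) := by
    have k1 := mul_le_mul_of_nonneg_left hlx htp.le
    have k2 := mul_le_mul_of_nonneg_left hlz (Nat.cast_nonneg (α := ℝ) s0)
    have k3 : (t0 : ℝ) * ((R + δ / t0) * F * Real.log 2) =
        (((F : ℕ) : ℝ) * Real.log 2) * (t0 * R + δ) := by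
      field_simp
    rw [k3] at k1
    linarith
  have e3 := hconv.trans (mul_le_mul_of_nonneg_left e2 h2A.le)
  rw [mul_assoc] at e3
  exact le_of_mul_le_mul_left (le_of_mul_le_mul_left e3 h2A) hfl

end MainPart

/-- **Order-optimality of memory-sharing in the multi-user setup.**
Under the regularity conditions, for `0 ≤ M ≤ N_1 + ⋯ + N_L`, any `M`-feasible
partition `(H, I, J)` and its memory-sharing allocation `m`, the memory-sharing rate
`R(M) = ∑_i R^SL(m_i, K, N_i, U_i)` is within a factor `192` of the optimal rate:
`R(M) ≤ 192 · R*(M)`. -/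
theorem memory_sharing_order_optimal (L : ℕ) (N U : Fin L → ℕ+) (K : ℕ+)
    (hreg : RegularML K (fun i => ((N i : ℕ) : ℝ)) (fun i => ((U i : ℕ) : ℝ)))
    (M : ℝ) (hM0 : 0 ≤ M) (hM1 : M ≤ ∑ i, ((N i : ℕ) : ℝ))
    (H I J : Finset (Fin L))
    (hfeas : MFeasible K (fun i => ((N i : ℕ) : ℝ)) (fun i => ((U i : ℕ) : ℝ)) M H I J) :
    ∑ i, RSL
        (msAlloc K (fun i => ((N i : ℕ) : ℝ)) (fun i => ((U i : ℕ) : ℝ)) M H I J i)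
        K ((N i : ℕ) : ℝ) ((U i : ℕ) : ℝ)
      ≤ 192 * RstarMU L N U K M := by
  obtain ⟨hdHI, hdHJ, hdIJ, hun, hIne, hH, hI, hJ⟩ := hfeas
  set y := Mtilde K (fun i => ((N i : ℕ) : ℝ)) (fun i => ((U i : ℕ) : ℝ)) M I J with hy
  have hK1 : (1 : ℝ) ≤ (K : ℝ) := by exact_mod_cast K.pos
  have hKp : (0 : ℝ) < (K : ℝ) := by linarith
  have hNp : ∀ i, (0 : ℝ) < ((N i : ℕ) : ℝ) := fun i => by exact_mod_cast (N i).pos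
  have hUp : ∀ i, (0 : ℝ) < ((U i : ℕ) : ℝ) := fun i => by exact_mod_cast (U i).pos
  let r : Fin L → ℝ := fun i => Real.sqrt (((N i : ℕ) : ℝ) / ((U i : ℕ) : ℝ))
  have hrp : ∀ i, 0 < r i := fun i => Real.sqrt_pos.2 (div_pos (hNp i) (hUp i))
  have hr2 : ∀ i, r i ^ 2 = ((N i : ℕ) : ℝ) / ((U i : ℕ) : ℝ) := fun i =>
    Real.sq_sqrt (div_pos (hNp i) (hUp i)).le
  have hN : ∀ i, ((N i : ℕ) : ℝ) = ((U i : ℕ) : ℝ) * r i ^ 2 := fun i => by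
    rw [hr2]; have := hUp i; field_simp
  have hrK : ∀ i, (K : ℝ) ≤ r i ^ 2 := fun i => by
    rw [hr2, le_div_iff₀ (hUp i)]; exact hreg.1 i
  have hsq : ∀ i, Real.sqrt (((N i : ℕ) : ℝ) * ((U i : ℕ) : ℝ)) = ((U i : ℕ) : ℝ) * r i := fun i => by
    rw [hN i, show ((U i : ℕ) : ℝ) * r i ^ 2 * ((U i : ℕ) : ℝ) = (((U i : ℕ) : ℝ) * r i) ^ 2 by ring]
    exact Real.sqrt_sq (mul_pos (hUp i) (hrp i)).le
  obtain ⟨i0, hi0⟩ := hIne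
  have hi0b : 1 / (K : ℝ) * r i0 ≤ y := (hI i0 hi0).1
  have hyp : 0 < y := lt_of_lt_of_le (mul_pos (by positivity) (hrp i0)) hi0b
  have hKy : 1 ≤ (K : ℝ) * y ^ 2 := by
    have h1 : (1 / (K : ℝ) * r i0) ^ 2 ≤ y ^ 2 :=
      pow_le_pow_left₀ (mul_pos (by positivity) (hrp i0)).le hi0b 2
    have h2 : (1 / (K : ℝ)) ^ 2 * K ≤ y ^ 2 := by
      refine le_trans (mul_le_mul_of_nonneg_left (hrK i0) (by positivity)) ?_
      rwa [← mul_pow]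
    have h3 := mul_le_mul_of_nonneg_left h2 hKp.le
    have h4 : (K : ℝ) * ((1 / (K : ℝ)) ^ 2 * K) = 1 := by field_simp
    linarith
  -- parameters
  obtain ⟨s0, t0, hs0, ht0, p1, p2, p3, p4⟩ := aux_params K y hK1 hyp hKy
  have hsp : (0 : ℝ) < s0 := by exact_mod_cast hs0
  have htp : (0 : ℝ) < t0 := by exact_mod_cast ht0
  obtain ⟨A, hA1, hA2⟩ := exists_nat_pow_near (x := (K : ℝ) / s0) (y := (2 : ℝ))
    (by rw [le_div_iff₀ hsp]; linarith) (by norm_num)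
  rw [le_div_iff₀ hsp, mul_comm] at hA1
  rw [div_lt_iff₀ hsp, pow_succ (2 : ℝ) A] at hA2
  have hA2' : (K : ℝ) < s0 * 2 ^ A * 2 := by linarith
  have hAK : s0 * 2 ^ A ≤ (K : ℕ) := by exact_mod_cast hA1
  set m := msAlloc K (fun i => ((N i : ℕ) : ℝ)) (fun i => ((U i : ℕ) : ℝ)) M H I J with hm
  have hmH : ∀ i ∈ H, m i = 0 := fun i hi => by simp [hm, msAlloc, hi]
  have hmI : ∀ i ∈ I, m i = ((U i : ℕ) : ℝ) * r i * y - ((N i : ℕ) : ℝ) / (K : ℝ) := fun i hi => by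
    have : i ∉ H := fun h => Finset.disjoint_left.1 hdHI h hi
    rw [← hsq i]
    simp [hm, msAlloc, hi, this, hy]
  have hmJ : ∀ i ∈ J, m i = ((N i : ℕ) : ℝ) := fun i hi => by
    have h1 : i ∉ H := fun h => Finset.disjoint_left.1 hdHJ h hi
    have h2 : i ∉ I := fun h => Finset.disjoint_left.1 hdIJ h hi
    simp [hm, msAlloc, h1, h2]
  -- total memory
  have hSpos : 0 < SA (fun i => ((N i : ℕ) : ℝ)) (fun i => ((U i : ℕ) : ℝ)) I := by
    unfold SA
    apply Finset.sum_pos _ ⟨i0, hi0⟩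
    intro i _
    exact Real.sqrt_pos.2 (mul_pos (hNp i) (hUp i))
  have hsum : ∑ i, m i = M := by
    rw [← hun, Finset.sum_union (Finset.disjoint_union_left.2 ⟨hdHJ, hdIJ⟩),
      Finset.sum_union hdHI, Finset.sum_congr rfl hmH, Finset.sum_congr rfl hmI,
      Finset.sum_congr rfl hmJ, Finset.sum_sub_distrib, ← Finset.sum_mul]
    have e1 : ∑ i ∈ I, ((U i : ℕ) : ℝ) * r i =
        SA (fun i => ((N i : ℕ) : ℝ)) (fun i => ((U i : ℕ) : ℝ)) I := by
      unfold SA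
      exact Finset.sum_congr rfl (fun i _ => (hsq i).symm)
    have e2 : SA (fun i => ((N i : ℕ) : ℝ)) (fun i => ((U i : ℕ) : ℝ)) I * y =
        M - TA (fun i => ((N i : ℕ) : ℝ)) J + VA K (fun i => ((N i : ℕ) : ℝ)) I := by
      rw [hy, Mtilde, mul_div_cancel₀ _ hSpos.ne']
    rw [e1, e2]
    simp only [TA, VA, Finset.sum_const_zero]
    ring
  -- per-level bound
  have hlev : ∀ i, ∃ a ≤ A, t0 * RSL (m i) K ((N i : ℕ) : ℝ) ((U i : ℕ) : ℝ) ≤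
      192 * (min ((N i : ℕ) : ℝ) (4 ^ a * s0 * t0 * ((U i : ℕ) : ℝ)) / 2 ^ a - s0 * m i) := by
    intro i
    have hi : i ∈ H ∪ I ∪ J := by rw [hun]; exact Finset.mem_univ i
    rw [Finset.mem_union, Finset.mem_union] at hi
    rcases hi with (hi | hi) | hi
    · refine ⟨A, le_rfl, ?_⟩
      have h1 : y < 1 / (K : ℝ) * r i := hH i hi
      have h2 : (K : ℝ) * y < r i := by
        have := mul_lt_mul_of_pos_left h1 hKp
        have e : (K : ℝ) * (1 / (K : ℝ) * r i) = r i := by field_simp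
        linarith
      have := aux_levelH K ((U i : ℕ) : ℝ) (r i) y s0 t0 A hs0 ht0 (hUp i) hyp hK1 p2 hA1 hA2' h2
      rw [hmH i hi, hN i]
      simpa [RSL] using this
    · obtain ⟨h1, h2⟩ := hI i hi
      have h1' : 1 / (K : ℝ) ≤ y / r i := by rw [le_div_iff₀ (hrp i)]; exact h1
      have h2' : y / r i ≤ 1 + 1 / (K : ℝ) := by rw [div_le_iff₀ (hrp i)]; exact h2
      have hmi : m i = ((U i : ℕ) : ℝ) * r i ^ 2 * (y / r i - 1 / (K : ℝ)) := by
        rw [hmI i hi, hN i]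
        have := hrp i
        field_simp
      have := aux_levelI K ((U i : ℕ) : ℝ) (r i) y (m i) s0 t0 A hs0 ht0 (hUp i) (hrp i) hyp (hrK i)
        hmi h1' h2' p1 p2 p3 hA2'
      rw [hN i]
      exact this
    · refine ⟨0, Nat.zero_le _, ?_⟩
      have := aux_levelJ K ((U i : ℕ) : ℝ) (r i) y s0 t0 (hUp i) (hrp i) (hrK i)
        (hJ i hi) p1 hs0 p3
      rw [hmJ i hi, hN i]
      exact this
  choose a haA hlev using hlev
  have hmain : ∀ R, MUAchievable L N U K R M →
      ∑ i, RSL (m i) K ((N i : ℕ) : ℝ) ((U i : ℕ) : ℝ) ≤ 192 * R := by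
    intro R hR
    have h1 := aux_rate L N U K R M hR s0 t0 A hs0 ht0 a haA hAK
    have h2 := Finset.sum_le_sum (fun i (_ : i ∈ Finset.univ) => hlev i)
    rw [← Finset.mul_sum, ← Finset.mul_sum, Finset.sum_sub_distrib, ← Finset.mul_sum, hsum] at h2
    have h3 : t0 * ∑ i, RSL (m i) K ((N i : ℕ) : ℝ) ((U i : ℕ) : ℝ) ≤ t0 * (192 * R) := by linarith
    exact le_of_mul_le_mul_left h3 htp
  have hfin : (∑ i, RSL (m i) K ((N i : ℕ) : ℝ) ((U i : ℕ) : ℝ)) / 192 ≤ RstarMU L N U K M := by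
    apply le_csInf (aux_nonempty L N U K M hM0)
    intro R hR
    have := hmain R hR
    linarith
  linarith
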